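/- arXiv:1110.0819 — 2 statements merged into one kernel-verified Lean document; each statement's English description precedes it below -/
import Mathlib

section
/- For every n ≥ 1, the function G(x_1,…,x_n) = (Σ_i x_i) · ln(Σ_i x_i) − Σ_i x_i ln x_i is concave on the open positive orthant {x ∈ ℝ^n : x_i > 0 for all i}. -/
open Finset

/-- Gibbs' inequality for unnormalized positive families: the linear functional
`x ↦ ∑ x_i (ln (∑ z_j) - ln z_i)` dominates the entropy difference of `x`. -/
lemma sum_mul_log_sum_sub_le {ι : Type*} [Fintype ι] {x z : ι → ℝ}
    (hx : ∀ i, 0 < x i) (hz : ∀ i, 0 < z i) :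
    (∑ i, x i) * Real.log (∑ i, x i) - ∑ i, x i * Real.log (x i) ≤
      ∑ i, x i * (Real.log (∑ j, z j) - Real.log (z i)) := by
  rcases isEmpty_or_nonempty ι with _ | _
  · simp
  have hX : 0 < ∑ i, x i := sum_pos (fun i _ => hx i) univ_nonempty
  have hZ : 0 < ∑ i, z i := sum_pos (fun i _ => hz i) univ_nonempty
  set X := ∑ i, x i with hXdef
  set Z := ∑ i, z i with hZdef
  have hterm (i : ι) : x i * (Real.log X - Real.log (x i)) -
      x i * (Real.log Z - Real.log (z i)) ≤ X / Z * z i - x i := by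
    have hlog := Real.log_le_sub_one_of_pos
      (div_pos (mul_pos hX (hz i)) (mul_pos (hx i) hZ))
    rw [Real.log_div (mul_pos hX (hz i)).ne' (mul_pos (hx i) hZ).ne',
      Real.log_mul hX.ne' (hz i).ne', Real.log_mul (hx i).ne' hZ.ne'] at hlog
    have hxi := (hx i).ne'
    calc x i * (Real.log X - Real.log (x i)) - x i * (Real.log Z - Real.log (z i))
        = x i * (Real.log X + Real.log (z i) - (Real.log (x i) + Real.log Z)) := by ring
      _ ≤ x i * (X * z i / (x i * Z) - 1) := mul_le_mul_of_nonneg_left hlog (hx i).le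
      _ = X / Z * z i - x i := by field_simp
  have hsum := sum_le_sum fun i (_ : i ∈ univ) => hterm i
  rw [sum_sub_distrib, sum_sub_distrib, ← mul_sum, ← hXdef, ← hZdef,
    div_mul_cancel₀ _ hZ.ne', sub_self] at hsum
  have hG : X * Real.log X - ∑ i, x i * Real.log (x i) =
      ∑ i, x i * (Real.log X - Real.log (x i)) := by
    simp only [mul_sub, sum_sub_distrib, ← sum_mul, ← hXdef]
  linarith

/-- the entropy-difference function
`G(x) = (∑ x_i) ln (∑ x_i) - ∑ x_i ln x_i` is concave on the open positive orthant. -/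
theorem stmt_6 (n : ℕ) (hn : 1 ≤ n) :
    ConcaveOn ℝ {x : Fin n → ℝ | ∀ i, 0 < x i}
      (fun x : Fin n → ℝ =>
        (∑ i, x i) * Real.log (∑ i, x i) - ∑ i, x i * Real.log (x i)) := by
  have hconv : Convex ℝ {x : Fin n → ℝ | ∀ i, 0 < x i} := fun x hx y hy a b ha hb hab i =>
    convex_Ioi (0 : ℝ) (hx i) (hy i) ha hb hab
  refine ⟨hconv, fun x hx y hy a b ha hb hab => ?_⟩
  have hz := hconv hx hy ha hb hab
  have hGx := mul_le_mul_of_nonneg_left (sum_mul_log_sum_sub_le hx hz) ha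
  have hGy := mul_le_mul_of_nonneg_left (sum_mul_log_sum_sub_le hy hz) hb
  refine (add_le_add hGx hGy).trans_eq ?_
  beta_reduce
  rw [mul_sum, mul_sum, ← sum_add_distrib, sum_mul, ← sum_sub_distrib]
  refine sum_congr rfl fun i _ => ?_
  simp only [Pi.add_apply, Pi.smul_apply, smul_eq_mul]
  ring
end

section
/- Let m ≥ 3, let σ be a real with 0 < σ < 1, and let r_1,…,r_m be reals with each r_j ∈ (0, σ/3) and r_1 + ⋯ + r_m = σ; put r_max = max_j r_j. Then there exists λ ∈ (2√r_max, 4√σ/3) satisfying √(1 − 4 r_1/λ²) + ⋯ + √(1 − 4 r_m/λ²) = m − 2. -/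
open Finset

lemma one_sub_two_thirds_mul_le_sqrt_one_sub {x : ℝ} (h0 : 0 ≤ x) (h1 : x ≤ 3 / 4) :
    1 - 2 / 3 * x ≤ Real.sqrt (1 - x) := by
  apply Real.le_sqrt_of_sq_le
  nlinarith

lemma sqrt_one_sub_le_one_sub_half {x : ℝ} (h : x ≤ 1) : Real.sqrt (1 - x) ≤ 1 - x / 2 := by
  rw [Real.sqrt_le_left (by linarith)]
  nlinarith [sq_nonneg x]

/-- existence of a root `λ ∈ (2√r_max, 4√σ/3)` of the equation
`√(1 - 4r_1/λ²) + ⋯ + √(1 - 4r_m/λ²) = m - 2`, where `r_1, …, r_m ∈ (0, σ/3)`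
sum to `σ < 1`. -/
theorem stmt_13 (m : ℕ) (hm : 3 ≤ m) (σ : ℝ) (hσ : 0 < σ) (hσ1 : σ < 1)
    (r : Fin m → ℝ)
    (hr : ∀ j, 0 < r j ∧ r j < σ / 3)
    (hsum : ∑ j, r j = σ)
    (rmax : ℝ) (hrmax : IsGreatest (Set.range r) rmax) :
    ∃ lam : ℝ, 2 * Real.sqrt rmax < lam ∧ lam < 4 * Real.sqrt σ / 3 ∧
      ∑ j, Real.sqrt (1 - 4 * r j / lam ^ 2) = (m : ℝ) - 2 := by
  obtain ⟨⟨i, hi⟩, hub⟩ := hrmax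
  have hle : ∀ j, r j ≤ rmax := fun j => hub ⟨j, rfl⟩
  have hpos : 0 < rmax := hi ▸ (hr i).1
  have hlt : rmax < σ / 3 := hi ▸ (hr i).2
  have hleft_sq : (2 * Real.sqrt rmax) ^ 2 = 4 * rmax := by
    rw [mul_pow, Real.sq_sqrt hpos.le]; norm_num
  have hright_sq : (4 * Real.sqrt σ / 3) ^ 2 = 16 * σ / 9 := by
    rw [div_pow, mul_pow, Real.sq_sqrt hσ.le]; norm_num
  have hleft_pos : 0 < 2 * Real.sqrt rmax := by positivity
  have hab : 2 * Real.sqrt rmax ≤ 4 * Real.sqrt σ / 3 := by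
    refine (pow_le_pow_iff_left₀ hleft_pos.le (by positivity) two_ne_zero).1 ?_
    rw [hleft_sq, hright_sq]
    linarith
  have hcont : ContinuousOn (fun lam : ℝ => ∑ j, Real.sqrt (1 - 4 * r j / lam ^ 2))
      (Set.Icc (2 * Real.sqrt rmax) (4 * Real.sqrt σ / 3)) := by
    refine continuousOn_finsetSum _ fun j _ => ContinuousOn.sqrt ?_
    refine continuousOn_const.sub (continuousOn_const.div (continuousOn_id.pow 2) ?_)
    intro x hx
    exact pow_ne_zero 2 (hleft_pos.trans_le hx.1).ne'
  have hleft : ∑ j, Real.sqrt (1 - 4 * r j / (2 * Real.sqrt rmax) ^ 2) < (m : ℝ) - 2 := by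
    rw [hleft_sq]
    have hterm : ∀ j ∈ univ, Real.sqrt (1 - 4 * r j / (4 * rmax)) ≤
        (1 - 1 / (2 * rmax) * r j) - if j = i then 1 / 2 else 0 := by
      intro j _
      have hx : 4 * r j / (4 * rmax) = r j / rmax := by field_simp
      rw [hx]
      split_ifs with h
      · rw [h, hi, div_self hpos.ne', sub_self, Real.sqrt_zero]
        apply le_of_eq
        field_simp
        norm_num
      · refine (sqrt_one_sub_le_one_sub_half ((div_le_one hpos).2 (hle j))).trans_eq ?_
        field_simp
        ring
    refine (sum_le_sum hterm).trans_lt ?_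
    rw [sum_sub_distrib, sum_sub_distrib, ← mul_sum, hsum]
    simp only [sum_const, card_univ, Fintype.card_fin, nsmul_eq_mul, mul_one, sum_ite_eq',
      mem_univ, if_true]
    have : 3 / 2 < 1 / (2 * rmax) * σ := by
      rw [one_div_mul_eq_div, lt_div_iff₀ (by positivity)]
      linarith
    linarith
  have hright : (m : ℝ) - 2 < ∑ j, Real.sqrt (1 - 4 * r j / (4 * Real.sqrt σ / 3) ^ 2) := by
    rw [hright_sq]
    have hterm : ∀ j ∈ univ, 1 - 3 / (2 * σ) * r j ≤
        Real.sqrt (1 - 4 * r j / (16 * σ / 9)) := by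
      intro j _
      have := hr j
      refine Eq.trans_le ?_ (one_sub_two_thirds_mul_le_sqrt_one_sub
        (div_nonneg (by linarith) (by linarith)) ?_)
      · field_simp
        ring
      · rw [div_le_iff₀ (by positivity)]
        linarith
    refine lt_of_lt_of_le ?_ (sum_le_sum hterm)
    rw [sum_sub_distrib, ← mul_sum, hsum]
    simp only [sum_const, card_univ, Fintype.card_fin, nsmul_eq_mul, mul_one]
    have : 3 / (2 * σ) * σ = 3 / 2 := by field_simp
    linarith
  obtain ⟨lam, ⟨h1, h2⟩, h3⟩ := intermediate_value_Ioo hab hcont ⟨hleft, hright⟩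
  exact ⟨lam, h1, h2, h3⟩
end
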